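/- Assume X is a connected locally finite poset satisfying conditions (M) and (D). If Φ is a K-algebra anti-automorphism of D(X,K), then there exist a unit θ of D(X,K), an order anti-automorphism λ of X, and k ∈ K* such that Φ = Ψ_θ ∘ ρ̃_λ ∘ (k̃δ). Moreover, if Φ is an involution, then λ can be taken to be an involution on X and k ∈ {−1, 1}. -/

import Mathlib

open TrivSqZeroExt

variable (K X : Type*) [Field K] [PartialOrder X] [LocallyFiniteOrder X] [DecidableEq X]

/-- The anti-automorphism `ρ_λ` of the incidence algebra induced by an order
anti-automorphism `lam` of `X`: `ρ_λ(f)(x,y) = f(λ(y), λ(x))`. -/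
def rhoLam (lam : X → X) (hlam : ∀ x y : X, x ≤ y ↔ lam y ≤ lam x)
    (f : IncidenceAlgebra K X) : IncidenceAlgebra K X :=
  ⟨fun x y => f (lam y) (lam x), fun x y hxy =>
    IncidenceAlgebra.apply_eq_zero_of_not_le (fun h => hxy ((hlam x y).mpr h)) f⟩

/-- The anti-automorphism `ρ̃_λ` of `D(X,K)`: `(f,i) ↦ (ρ_λ(f), ρ_λ(i))`. -/
def rhoTilde (lam : X → X) (hlam : ∀ x y : X, x ≤ y ↔ lam y ≤ lam x)
    (d : TrivSqZeroExt (IncidenceAlgebra K X) (IncidenceAlgebra K X)) :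
    TrivSqZeroExt (IncidenceAlgebra K X) (IncidenceAlgebra K X) :=
  inl (rhoLam K X lam hlam d.fst) + inr (rhoLam K X lam hlam d.snd)

/-- The automorphism `k̃δ` of `D(X,K)`: `(f,i) ↦ (f, k·i)`. -/
def kTilde (k : K) (d : TrivSqZeroExt (IncidenceAlgebra K X) (IncidenceAlgebra K X)) :
    TrivSqZeroExt (IncidenceAlgebra K X) (IncidenceAlgebra K X) :=
  inl d.fst + inr (k • d.snd)

/-- Condition (M): every multiplicative automorphism of `I(X,K)` is inner. -/
def CondM : Prop :=
  ∀ σ : X → X → K, (∀ x y : X, x ≤ y → σ x y ≠ 0) →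
    (∀ x y z : X, x ≤ y → y ≤ z → σ x y * σ y z = σ x z) →
    ∃ u : (IncidenceAlgebra K X)ˣ, ∀ (f : IncidenceAlgebra K X) (x y : X), x ≤ y →
      (↑u * f * ↑u⁻¹ : IncidenceAlgebra K X) x y = σ x y * f x y

/-- Condition (D): every `K`-linear derivation of `I(X,K)` is inner. -/
def CondD : Prop :=
  ∀ Der : IncidenceAlgebra K X → IncidenceAlgebra K X,
    (∀ f g, Der (f + g) = Der f + Der g) →
    (∀ (k : K) (f : IncidenceAlgebra K X), Der (k • f) = k • Der f) →
    (∀ f g, Der (f * g) = Der f * g + f * Der g) →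
    ∃ i : IncidenceAlgebra K X, ∀ f, Der f = f * i - i * f

/-- Connectedness of the poset `X`. -/
def PosetConnected : Prop :=
  ∀ x y : X, Relation.ReflTransGen (fun a b : X => a ≤ b ∨ b ≤ a) x y

namespace IncidenceAlgebra

open Finset

variable {K X}

/-- The matrix unit of the incidence algebra supported at the pair `(x, y)`, for `x ≤ y`. -/
def single {x y : X} (h : x ≤ y) : IncidenceAlgebra K X :=
  ⟨fun a b => if a = x ∧ b = y then 1 else 0, fun _ _ hab =>
    if_neg fun ⟨ha, hb⟩ => hab (ha ▸ hb ▸ h)⟩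

lemma single_apply {x y : X} (h : x ≤ y) (a b : X) :
    (single h : IncidenceAlgebra K X) a b = if a = x ∧ b = y then 1 else 0 := rfl

lemma single_mul_apply {x y : X} (h : x ≤ y) (f : IncidenceAlgebra K X) (a b : X) :
    (single h * f : IncidenceAlgebra K X) a b = if a = x then f y b else 0 := by
  simp only [mul_apply, single_apply]
  split_ifs with hax
  · subst hax
    by_cases hyb : y ≤ b
    · simp [h, hyb]
    · simp [hyb, apply_eq_zero_of_not_le hyb f]
  · simp [hax]

lemma mul_single_apply {x y : X} (h : x ≤ y) (f : IncidenceAlgebra K X) (a b : X) :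
    (f * single h : IncidenceAlgebra K X) a b = if b = y then f a x else 0 := by
  simp only [mul_apply, single_apply]
  split_ifs with hby
  · subst hby
    by_cases hax : a ≤ x
    · simp [h, hax]
    · simp [hax, apply_eq_zero_of_not_le hax f]
  · simp [hby]

/-- The diagonal idempotent of the incidence algebra at `x`. -/
abbrev idem (x : X) : IncidenceAlgebra K X := single (le_refl x)

lemma idem_mul_idem_self (x : X) : (idem x * idem x : IncidenceAlgebra K X) = idem x := by
  ext a b _
  rw [single_mul_apply, single_apply, single_apply]
  split_ifs <;> simp_all

lemma idem_mul_idem_of_ne {x y : X} (h : x ≠ y) :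
    (idem x * idem y : IncidenceAlgebra K X) = 0 := by
  ext a b _
  rw [single_mul_apply, single_apply]
  simp [h]

lemma idem_ne_zero (x : X) : (idem x : IncidenceAlgebra K X) ≠ 0 := fun h => by
  simpa [single_apply] using congr($h x x)

lemma mul_idem_mul_apply (f g : IncidenceAlgebra K X) (a b c : X) :
    (f * idem b * g : IncidenceAlgebra K X) a c = f a b * g b c := by
  rw [mul_assoc, mul_apply]
  simp only [single_mul_apply]
  by_cases hab : a ≤ b
  · by_cases hbc : b ≤ c
    · simp [hab, hbc]
    · simp [apply_eq_zero_of_not_le hbc g]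
  · simp [hab, apply_eq_zero_of_not_le hab f]

lemma idem_mul_mul_idem {x y : X} (h : x ≤ y) (f : IncidenceAlgebra K X) :
    idem x * f * idem y = f x y • single h := by
  ext a b _
  rw [mul_single_apply, single_mul_apply, constSMul_apply, single_apply]
  split_ifs <;> simp_all

lemma idem_mul_mul_idem_of_not_le {x y : X} (h : ¬ x ≤ y) (f : IncidenceAlgebra K X) :
    idem x * f * idem y = 0 := by
  ext a b _
  rw [mul_single_apply, single_mul_apply, apply_eq_zero_of_not_le h]
  simp

lemma mul_apply_self (f g : IncidenceAlgebra K X) (x : X) : (f * g) x x = f x x * g x x := by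
  simp

lemma exists_apply_self_ne_zero {p : IncidenceAlgebra K X} (hp : p * p = p) (h0 : p ≠ 0) :
    ∃ y, p y y ≠ 0 := by
  by_contra! hd
  refine h0 (ext fun a b _ => ?_)
  rw [zero_apply]
  induction hn : (Icc a b).card using Nat.strong_induction_on generalizing b with
  | _ n ih =>
    rw [← hp, mul_apply]
    refine sum_eq_zero fun z hz => ?_
    obtain ⟨haz, hzb⟩ := mem_Icc.1 hz
    rcases hzb.eq_or_lt with rfl | hlt
    · rw [hd, mul_zero]
    · rw [ih _ ?_ z haz rfl, zero_mul]
      rw [← hn]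
      exact card_lt_card (Icc_ssubset_Icc_right (haz.trans hzb) le_rfl hlt)

/-- The left inverse of a unipotent element, as a bare function defined recursively. -/
def leftInvFun (f : IncidenceAlgebra K X) (a : X) : X → K
  | b =>
    if a = b then 1
    else
      -∑ z ∈ (Ico a b).attach,
          have : (Icc a z.1).card < (Icc a b).card :=
            card_lt_card (Icc_ssubset_Icc_right
              ((mem_Ico.1 z.2).1.trans (mem_Ico.1 z.2).2.le) le_rfl (mem_Ico.1 z.2).2)
          leftInvFun f a z.1 * f z.1 b
termination_by b => (Icc a b).card

lemma leftInvFun_apply (f : IncidenceAlgebra K X) (a b : X) :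
    leftInvFun f a b = if a = b then 1 else -∑ z ∈ Ico a b, leftInvFun f a z * f z b := by
  rw [leftInvFun, ← sum_attach (Ico a b)]

lemma exists_mul_eq_one {f : IncidenceAlgebra K X} (hf : ∀ x, f x x = 1) :
    ∃ g : IncidenceAlgebra K X, (∀ x, g x x = 1) ∧ g * f = 1 := by
  refine ⟨⟨leftInvFun f, fun a b hab => ?_⟩, fun x => ?_, ext fun a b hab => ?_⟩
  · rw [leftInvFun_apply, if_neg fun h => hab h.le, Ico_eq_empty fun h => hab h.le, sum_empty,
      neg_zero]
  · simp [leftInvFun_apply f x x]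
  · rw [mul_apply, one_apply, coe_mk]
    split_ifs with h
    · subst h
      simp [leftInvFun_apply f a a, hf]
    · rw [Icc_eq_cons_Ico hab, sum_cons, hf, leftInvFun_apply f a b, if_neg h]
      simp

lemma isUnit_of_apply_self_eq_one {f : IncidenceAlgebra K X} (hf : ∀ x, f x x = 1) :
    IsUnit f := by
  obtain ⟨g, hg, hgf⟩ := exists_mul_eq_one hf
  obtain ⟨g', -, hgg⟩ := exists_mul_eq_one hg
  have : g' = f := left_inv_eq_right_inv hgg hgf
  exact ⟨⟨f, g, this ▸ hgg, hgf⟩, rfl⟩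

lemma eq_smul_one_of_commute (hconn : PosetConnected X) {f : IncidenceAlgebra K X}
    (hf : ∀ g, g * f = f * g) (x₀ : X) : f = f x₀ x₀ • 1 := by
  have hstep : ∀ x y, x ≤ y → f y y = f x x := fun x y h => by
    have := congr($(hf (single h)) x y)
    rw [single_mul_apply, mul_single_apply] at this
    simpa using this
  have hdiag : ∀ x, f x x = f x₀ x₀ := fun x => by
    induction hconn x₀ x with
    | refl => rfl
    | tail _ h ih =>
      rcases h with h | h
      · rw [hstep _ _ h, ih]
      · rw [← ih, hstep _ _ h]
  ext a b _
  rw [constSMul_apply, one_apply]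
  split_ifs with h
  · rw [← h, hdiag]; simp
  · have := congr($(hf (idem a)) a b)
    rw [single_mul_apply, mul_single_apply] at this
    simpa [Ne.symm h] using this

section AntiAutomorphism

variable {φ : IncidenceAlgebra K X ≃ₗ[K] IncidenceAlgebra K X}

lemma symm_map_mul_anti (hφ : ∀ f g, φ (f * g) = φ g * φ f) (f g : IncidenceAlgebra K X) :
    φ.symm (f * g) = φ.symm g * φ.symm f := by
  apply φ.injective
  simp [hφ]

lemma anti_map_idem_mul_mul (hφ : ∀ f g, φ (f * g) = φ g * φ f) (x : X)
    (f : IncidenceAlgebra K X) :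
    φ (idem x) * f * φ (idem x) = φ.symm f x x • φ (idem x) := by
  rw [← map_smul, ← idem_mul_mul_idem, hφ, hφ, φ.apply_symm_apply, mul_assoc]

lemma exists_diag_anti_map_idem (hφ : ∀ f g, φ (f * g) = φ g * φ f) (x : X) :
    ∃ y, φ (idem x) y y = 1 ∧ φ (idem x) * idem y * φ (idem x) = φ (idem x) ∧
      ∀ z, φ (idem x) z z ≠ 0 → z = y := by
  have hp : φ (idem x) * φ (idem x) = φ (idem x) := by rw [← hφ, idem_mul_idem_self]
  obtain ⟨y, hy⟩ := exists_apply_self_ne_zero hp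
    (fun h => idem_ne_zero (K := K) x (φ.injective (by simpa using h)))
  have hy1 : φ (idem x) y y = 1 := by
    have := congr($hp y y)
    rw [mul_apply_self] at this
    exact mul_left_cancel₀ hy (by rw [this, mul_one])
  have hmul := anti_map_idem_mul_mul hφ x (idem y)
  have hc : φ.symm (idem y) x x = 1 := by
    have := congr($hmul y y)
    rw [mul_idem_mul_apply, constSMul_apply, hy1] at this
    simpa using this.symm
  rw [hc, one_smul] at hmul
  refine ⟨y, hy1, hmul, fun z hz => by_contra fun hzy => hz ?_⟩
  rw [← hmul, mul_apply_self, mul_apply_self, single_apply]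
  simp [hzy]

/-- An anti-automorphism permutes the diagonal idempotents up to conjugation of each of them,
and the permutation reverses the order. -/
lemma exists_equiv_anti_map_idem (hφ : ∀ f g, φ (f * g) = φ g * φ f) :
    ∃ μ : X ≃ X, (∀ x y, x ≤ y ↔ μ y ≤ μ x) ∧ ∀ x, φ (idem x) (μ x) (μ x) = 1 := by
  choose μ hone hmul huniq using exists_diag_anti_map_idem hφ
  have hmul' : ∀ x, idem (μ x) * φ (idem x) * idem (μ x) = idem (μ x) := fun x => by
    rw [idem_mul_mul_idem le_rfl, hone, one_smul]
  have hle : ∀ x y, x ≤ y ↔ μ y ≤ μ x := by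
    refine fun x y => ⟨fun h => by_contra fun hn => ?_, fun h => by_contra fun hn => ?_⟩
    · have hs : (single h : IncidenceAlgebra K X) = 0 := by
        apply φ.injective
        have h1 : (single h : IncidenceAlgebra K X) = idem x * single h * idem y := by
          rw [idem_mul_mul_idem h]; simp [single_apply]
        rw [map_zero, h1, hφ, hφ, ← hmul x, ← hmul y]
        have := idem_mul_mul_idem_of_not_le hn
          (φ (idem y) * (φ (single h) * φ (idem x)))
        calc _ = φ (idem y) *
              (idem (μ y) * (φ (idem y) * (φ (single h) * φ (idem x))) * idem (μ x)) *
              φ (idem x) := by noncomm_ring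
          _ = 0 := by rw [this]; simp
      simpa [single_apply] using congr($hs x y)
    · have hs : (single h : IncidenceAlgebra K X) = 0 := by
        have h1 : (single h : IncidenceAlgebra K X) = idem (μ y) * single h * idem (μ x) := by
          rw [idem_mul_mul_idem h]; simp [single_apply]
        have h2 : ∀ f, φ (idem y) * f * φ (idem x) = 0 := fun f => by
          rw [← φ.apply_symm_apply f, mul_assoc, ← hφ, ← hφ,
            idem_mul_mul_idem_of_not_le hn, map_zero]
        rw [h1, ← hmul' x, ← hmul' y]
        calc _ = idem (μ y) *
              (φ (idem y) * (idem (μ y) * single h * idem (μ x)) * φ (idem x)) *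
              idem (μ x) := by noncomm_ring
          _ = 0 := by rw [h2]; simp
      simpa [single_apply] using congr($hs (μ y) (μ x))
  refine ⟨Equiv.ofBijective μ ⟨fun x y h => ?_, fun y => ?_⟩, hle, hone⟩
  · exact le_antisymm ((hle x y).2 h.ge) ((hle y x).2 h.le)
  · obtain ⟨x, hx, -, -⟩ := exists_diag_anti_map_idem (symm_map_mul_anti hφ) y
    refine ⟨x, (huniq x y ?_).symm⟩
    have := anti_map_idem_mul_mul hφ x (idem y)
    rw [hx, one_smul] at this
    intro h0
    have h1 := congr($this (μ x) (μ x))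
    rw [mul_idem_mul_apply, hone] at h1
    by_cases hy : y = μ x
    · rw [hy, hone] at h0
      exact one_ne_zero h0
    · have hle1 : φ (idem x) (μ x) y = 0 ∨ φ (idem x) y (μ x) = 0 := by
        by_contra! hne
        exact hy (le_antisymm (le_of_ne_zero hne.2) (le_of_ne_zero hne.1))
      rcases hle1 with h | h <;> simp [h] at h1

/-- Some unit conjugates the image of each diagonal idempotent to a diagonal idempotent. -/
lemma exists_unit_anti_map_idem_mul (hφ : ∀ f g, φ (f * g) = φ g * φ f) (μ : X ≃ X)
    (hone : ∀ x, φ (idem x) (μ x) (μ x) = 1) :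
    ∃ w : (IncidenceAlgebra K X)ˣ, ∀ x,
      φ (idem x) * (w : IncidenceAlgebra K X) = (w : IncidenceAlgebra K X) * idem (μ x) := by
  let w : IncidenceAlgebra K X := ⟨fun a b => φ (idem (μ.symm b)) a b, fun a b h =>
    apply_eq_zero_of_not_le h _⟩
  have hw : ∀ a b, w a b = φ (idem (μ.symm b)) a b := fun _ _ => rfl
  have hunit : IsUnit w := isUnit_of_apply_self_eq_one fun x => by
    simpa [hw] using hone (μ.symm x)
  refine ⟨hunit.unit, fun x => ext fun a b _ => ?_⟩
  rw [hunit.unit_spec, mul_single_apply]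
  have h1 : (φ (idem x) * w) a b = φ (idem (μ.symm b) * idem x) a b := by
    rw [hφ, mul_apply, mul_apply]
    rfl
  rw [h1]
  split_ifs with hb
  · subst hb
    simp [hw, idem_mul_idem_self]
  · rw [idem_mul_idem_of_ne fun h => hb (by simp [← h])]
    simp

/-- An anti-automorphism sending diagonal idempotents to diagonal idempotents acts entrywise. -/
lemma exists_multiplicative_of_anti_map_idem (hφ : ∀ f g, φ (f * g) = φ g * φ f)
    (lam : X → X) (hlam : ∀ x y, x ≤ y ↔ lam y ≤ lam x)
    (hidem : ∀ x, φ (idem (lam x)) = idem x) :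
    ∃ σ : X → X → K, (∀ x y, x ≤ y → σ x y ≠ 0) ∧
      (∀ x y z, x ≤ y → y ≤ z → σ x y * σ y z = σ x z) ∧
      ∀ f x y, x ≤ y → φ f x y = σ x y * f (lam y) (lam x) := by
  have hex : ∀ x y, ∃ c : K, ∀ f, x ≤ y → φ f x y = c * f (lam y) (lam x) := fun x y => by
    by_cases h : x ≤ y
    · refine ⟨φ (single ((hlam x y).1 h)) x y, fun f _ => ?_⟩
      have h1 := congr(φ $(idem_mul_mul_idem ((hlam x y).1 h) f) x y)
      rw [hφ, hφ, hidem, hidem, ← mul_assoc, idem_mul_mul_idem h, map_smul] at h1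
      simpa [constSMul_apply, single_apply, mul_comm] using h1
    · exact ⟨0, fun _ h' => absurd h' h⟩
  choose σ hσ using hex
  refine ⟨σ, fun x y h h0 => ?_, fun x y z hxy hyz => ?_, fun f x y h => hσ x y f h⟩
  · have := hσ x y (φ.symm (single h)) h
    simp [single_apply, h0] at this
  · have h1 : (φ (single ((hlam x y).1 hxy)) * idem y * φ (single ((hlam y z).1 hyz)) :
        IncidenceAlgebra K X) x z =
        φ (single ((hlam y z).1 hyz) * idem (lam y) * single ((hlam x y).1 hxy)) x z := by
      rw [hφ, hφ, hidem, mul_assoc]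
    rw [mul_idem_mul_apply, hσ _ _ _ (hxy.trans hyz), hσ _ _ _ hxy,
      hσ _ _ _ hyz, mul_idem_mul_apply] at h1
    simpa [single_apply] using h1

/-- Under condition (M), every anti-automorphism of the incidence algebra is the composition of
an inner automorphism and the anti-automorphism induced by an order anti-automorphism. -/
theorem exists_anti_eq_conj_rhoLam (hM : CondM K X) (hφ : ∀ f g, φ (f * g) = φ g * φ f) :
    ∃ (u : (IncidenceAlgebra K X)ˣ) (lam : X → X) (hlam : ∀ x y : X, x ≤ y ↔ lam y ≤ lam x),
      Function.Bijective lam ∧ ∀ f, φ f = u * rhoLam K X lam hlam f * ↑u⁻¹ := by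
  obtain ⟨μ, hμ, hone⟩ := exists_equiv_anti_map_idem hφ
  obtain ⟨w, hw⟩ := exists_unit_anti_map_idem_mul hφ μ hone
  have hlam : ∀ x y, x ≤ y ↔ μ.symm y ≤ μ.symm x := fun x y => by simp [hμ (μ.symm y)]
  let c : IncidenceAlgebra K X ≃ₗ[K] IncidenceAlgebra K X :=
    { toFun := fun f => ↑w⁻¹ * f * w
      invFun := fun f => w * f * ↑w⁻¹
      map_add' := fun f g => by noncomm_ring
      map_smul' := fun k f => by simp
      left_inv := fun f => by simp [mul_assoc]
      right_inv := fun f => by simp [mul_assoc] }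
  have hc : ∀ f, c f = ↑w⁻¹ * f * w := fun _ => rfl
  obtain ⟨σ, hσ0, hσm, hσ⟩ := exists_multiplicative_of_anti_map_idem (φ := φ.trans c)
    (fun f g => by simp [hc, hφ, mul_assoc]) μ.symm hlam
    (fun x => by
      rw [LinearEquiv.trans_apply, hc, mul_assoc, hw]
      simp)
  obtain ⟨v, hv⟩ := hM σ hσ0 hσm
  refine ⟨w * v, μ.symm, hlam, μ.symm.bijective, fun f => ?_⟩
  have key : ↑w⁻¹ * φ f * w = v * rhoLam K X μ.symm hlam f * ↑v⁻¹ := ext fun a b hab => by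
    rw [hv _ _ _ hab]
    exact hσ f a b hab
  calc φ f = w * (↑w⁻¹ * φ f * w) * ↑w⁻¹ := by simp [mul_assoc]
    _ = _ := by rw [key]; simp [mul_assoc]

end AntiAutomorphism

section Idealization

variable {Φ : TrivSqZeroExt (IncidenceAlgebra K X) (IncidenceAlgebra K X) →
  TrivSqZeroExt (IncidenceAlgebra K X) (IncidenceAlgebra K X)}

lemma rhoLam_one {lam : X → X} (hlam : ∀ x y : X, x ≤ y ↔ lam y ≤ lam x) :
    rhoLam K X lam hlam 1 = 1 := by
  have hinj : Function.Injective lam := fun x y h =>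
    le_antisymm ((hlam x y).2 h.ge) ((hlam y x).2 h.le)
  ext a b _
  change (1 : IncidenceAlgebra K X) (lam b) (lam a) = _
  simp [hinj.eq_iff, eq_comm]

lemma rhoLam_smul {lam : X → X} (hlam : ∀ x y : X, x ≤ y ↔ lam y ≤ lam x) (k : K)
    (f : IncidenceAlgebra K X) : rhoLam K X lam hlam (k • f) = k • rhoLam K X lam hlam f := rfl

/-- A central element of square zero in the idealization of the incidence algebra of a connected
poset is a scalar multiple of `(0, 1)`. -/
lemma eq_inr_smul_one_of_central (hconn : PosetConnected X)
    {e : TrivSqZeroExt (IncidenceAlgebra K X) (IncidenceAlgebra K X)}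
    (he : ∀ u, u * e = e * u) (hsq : e * e = 0) (x₀ : X) : e = inr (e.snd x₀ x₀ • 1) := by
  have hfst : ∀ g, g * e.fst = e.fst * g := fun g => by
    simpa using congr(fst $(he (inl g)))
  have hsnd : ∀ g, g * e.snd = e.snd * g := fun g => by
    simpa using congr(snd $(he (inl g)))
  ext1
  · have h0 : e.fst x₀ x₀ = 0 := by
      have := congr(fst $hsq x₀ x₀)
      rw [fst_mul, mul_apply_self] at this
      simpa using this
    rw [eq_smul_one_of_commute hconn hfst x₀, h0]
    simp
  · rw [snd_inr]
    exact eq_smul_one_of_commute hconn hsnd x₀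

/-- An anti-automorphism of the idealization is triangular with respect to the decomposition
into the incidence algebra and the square-zero ideal, with proportional diagonal blocks. -/
lemma exists_linearEquiv_of_anti [Nonempty X] (hconn : PosetConnected X)
    (hadd : ∀ u v, Φ (u + v) = Φ u + Φ v) (hsmul : ∀ (k : K) u, Φ (k • u) = k • Φ u)
    (hanti : ∀ u v, Φ (u * v) = Φ v * Φ u) (hbij : Function.Bijective Φ) :
    ∃ (φ : IncidenceAlgebra K X ≃ₗ[K] IncidenceAlgebra K X) (k : K), k ≠ 0 ∧
      (∀ f g, φ (f * g) = φ g * φ f) ∧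
      ∀ d, (Φ d).fst = φ d.fst ∧ (Φ d).snd = (Φ (inl d.fst)).snd + k • φ d.snd := by
  obtain ⟨x₀⟩ := ‹Nonempty X›
  have hzero : Φ 0 = 0 := by simpa using hadd 0 0
  let ε : TrivSqZeroExt (IncidenceAlgebra K X) (IncidenceAlgebra K X) := inr 1
  have hε : ∀ u, u * ε = ε * u := fun u => by ext1 <;> simp [ε]
  have hεsq : ε * ε = 0 := inr_mul_inr _ _ _
  have hΦε : Φ ε = inr ((Φ ε).snd x₀ x₀ • 1) :=
    eq_inr_smul_one_of_central hconn
      (fun u => by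
        obtain ⟨v, rfl⟩ := hbij.2 u
        rw [← hanti, ← hanti, hε])
      (by rw [← hanti, hεsq, hzero]) x₀
  set k : K := (Φ ε).snd x₀ x₀ with hk
  have hinr : ∀ i, Φ (inr i) = inr (k • (Φ (inl i)).fst) := fun i => by
    have h1 : (inr i : TrivSqZeroExt (IncidenceAlgebra K X) (IncidenceAlgebra K X)) =
        inl i * ε := by ext1 <;> simp [ε]
    rw [h1, hanti, hΦε]
    ext1 <;> simp
  have hk0 : k ≠ 0 := fun h => by
    have h1 : ε = 0 := hbij.1 (by rw [hΦε, h, hzero]; simp)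
    simpa [ε] using congr(snd $h1 x₀ x₀)
  let φ₀ : IncidenceAlgebra K X →ₗ[K] IncidenceAlgebra K X :=
    { toFun := fun f => (Φ (inl f)).fst
      map_add' := fun f g => by rw [inl_add, hadd, fst_add]
      map_smul' := fun c f => by rw [inl_smul, hsmul, fst_smul]; rfl }
  have hφ₀ : ∀ f, φ₀ f = (Φ (inl f)).fst := fun _ => rfl
  have hsplit : ∀ d, Φ d = Φ (inl d.fst) + inr (k • φ₀ d.snd) := fun d => by
    rw [hφ₀, ← hinr, ← hadd, inl_fst_add_inr_snd_eq]
  have hsurj : Function.Surjective φ₀ := fun f => by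
    obtain ⟨d, hd⟩ := hbij.2 (inl f)
    refine ⟨d.fst, ?_⟩
    have := congr(fst $(hsplit d))
    rw [hd, fst_inl, fst_add, fst_inr, add_zero] at this
    rw [hφ₀, this]
  have hinj : Function.Injective φ₀ := (injective_iff_map_eq_zero _).2 fun f hf => by
    obtain ⟨g, hg⟩ := hsurj (k⁻¹ • (Φ (inl f)).snd)
    have h1 : Φ (inl f) = Φ (inr g) := by
      rw [hinr, ← hφ₀, hg, smul_inv_smul₀ hk0]
      ext1
      · rw [← hφ₀, hf, fst_inr]
      · rw [snd_inr]
    simpa using congr(fst $(hbij.1 h1))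
  obtain ⟨φ, hφ⟩ : ∃ φ : IncidenceAlgebra K X ≃ₗ[K] IncidenceAlgebra K X, ∀ f, φ f = φ₀ f :=
    ⟨LinearEquiv.ofBijective φ₀ ⟨hinj, hsurj⟩, fun _ => rfl⟩
  refine ⟨φ, k, hk0, fun f g => ?_, fun d => ?_⟩
  · simp only [hφ, hφ₀, inl_mul, hanti, fst_mul]
  · rw [hsplit d]
    simp only [hφ, fst_add, snd_add, fst_inr, snd_inr, add_zero, ← hφ₀, and_self]

/-- Every anti-automorphism of the idealization is the composition of an inner automorphism, an
anti-automorphism induced by the order and a scaling of the square-zero ideal. -/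
lemma exists_anti_eq_conj_rhoTilde_kTilde [Nonempty X] (hconn : PosetConnected X)
    (hM : CondM K X) (hD : CondD K X)
    (hadd : ∀ u v, Φ (u + v) = Φ u + Φ v) (hsmul : ∀ (k : K) u, Φ (k • u) = k • Φ u)
    (hanti : ∀ u v, Φ (u * v) = Φ v * Φ u) (hbij : Function.Bijective Φ) :
    ∃ (θ : (TrivSqZeroExt (IncidenceAlgebra K X) (IncidenceAlgebra K X))ˣ)
      (lam : X → X) (hlam : ∀ x y : X, x ≤ y ↔ lam y ≤ lam x) (k : K),
      Function.Bijective lam ∧ k ≠ 0 ∧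
      ∀ d, Φ d = ↑θ * rhoTilde K X lam hlam (kTilde K X k d) * ↑θ⁻¹ := by
  obtain ⟨φ, k, hk0, hφ, hΦ⟩ := exists_linearEquiv_of_anti hconn hadd hsmul hanti hbij
  obtain ⟨u, lam, hlam, hbl, hu⟩ := exists_anti_eq_conj_rhoLam hM hφ
  obtain ⟨i, hi⟩ := hD (fun f => (Φ (inl (φ.symm f))).snd)
    (fun f g => by rw [map_add, inl_add, hadd, snd_add])
    (fun c f => by rw [map_smul, inl_smul, hsmul, snd_smul])
    (fun f g => by
      rw [symm_map_mul_anti hφ, inl_mul, hanti, snd_mul, (hΦ _).1, (hΦ _).1]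
      simp [add_comm])
  have hd : ∀ f, (Φ (inl f)).snd = φ f * i - i * φ f := fun f => by
    simpa using hi (φ f)
  let θ : (TrivSqZeroExt (IncidenceAlgebra K X) (IncidenceAlgebra K X))ˣ :=
    ⟨inl (u : IncidenceAlgebra K X) - inr (i * u),
      inl (↑u⁻¹ : IncidenceAlgebra K X) + inr (↑u⁻¹ * i),
      by ext1 <;> simp [mul_assoc], by ext1 <;> simp [← mul_assoc]⟩
  have hθ : (θ : TrivSqZeroExt (IncidenceAlgebra K X) (IncidenceAlgebra K X)) =
    inl (u : IncidenceAlgebra K X) - inr (i * u) := rfl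
  refine ⟨θ, lam, hlam, k, hbl, hk0, fun d => ?_⟩
  rw [Units.eq_mul_inv_iff_mul_eq, hθ]
  have hφu : ∀ f, φ f * u = u * rhoLam K X lam hlam f := fun f => by simp [hu]
  ext1
  · simp [rhoTilde, kTilde, (hΦ d).1, hφu]
  · simp only [snd_mul, fst_sub, snd_sub, fst_inl, snd_inl, fst_inr, snd_inr, (hΦ d).1, (hΦ d).2,
      hd, rhoTilde, kTilde, fst_add, snd_add, smul_eq_mul, MulOpposite.smul_eq_mul_unop,
      MulOpposite.unop_op, rhoLam_smul, sub_zero, zero_sub, add_zero, zero_add]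
    rw [neg_mul, mul_assoc i, ← hφu, mul_smul_comm, ← hφu, add_mul, smul_mul_assoc]
    noncomm_ring

/-- The parameters of an involution of the idealization. -/
lemma involutive_of_anti_involutive [Nonempty X]
    (θ : (TrivSqZeroExt (IncidenceAlgebra K X) (IncidenceAlgebra K X))ˣ)
    {lam : X → X} (hlam : ∀ x y : X, x ≤ y ↔ lam y ≤ lam x) (k : K)
    (hΦ : ∀ d, Φ d = ↑θ * rhoTilde K X lam hlam (kTilde K X k d) * ↑θ⁻¹)
    (hinv : ∀ u, Φ (Φ u) = u) :
    (∀ x, lam (lam x) = x) ∧ (k = 1 ∨ k = -1) := by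
  have hdiag : ∀ d x, (Φ d).fst x x = d.fst (lam x) (lam x) := fun d x => by
    have h1 : (θ : TrivSqZeroExt (IncidenceAlgebra K X) (IncidenceAlgebra K X)).fst x x *
        (↑θ⁻¹ : TrivSqZeroExt (IncidenceAlgebra K X) (IncidenceAlgebra K X)).fst x x = 1 := by
      rw [← mul_apply_self, ← fst_mul, θ.mul_inv]
      simp
    have h2 : (rhoTilde K X lam hlam (kTilde K X k d)).fst x x = d.fst (lam x) (lam x) := by
      simp [rhoTilde, kTilde, rhoLam]
    rw [hΦ, fst_mul, fst_mul, mul_apply_self, mul_apply_self, h2, mul_right_comm, h1, one_mul]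
  refine ⟨fun x => by_contra fun hne => ?_, ?_⟩
  · have h1 := congr(fst $(hinv (inl (idem x))) x x)
    rw [hdiag, hdiag, fst_inl, single_apply, single_apply] at h1
    simp [hne] at h1
  · have hinr : ∀ c : K, Φ (inr (c • 1)) = inr ((k * c) • 1) := fun c => by
      have h1 : rhoTilde K X lam hlam (kTilde K X k (inr (c • 1))) = inr ((k * c) • 1) := by
        ext1
        · simp only [rhoTilde, kTilde, fst_add, fst_inl, fst_inr, add_zero]
          rfl
        · simp [rhoTilde, kTilde, rhoLam_smul, rhoLam_one, mul_smul]
      have h2 : (θ : TrivSqZeroExt (IncidenceAlgebra K X) (IncidenceAlgebra K X)) *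
          inr ((k * c) • 1) =
            inr ((k * c) • 1) *
              (θ : TrivSqZeroExt (IncidenceAlgebra K X) (IncidenceAlgebra K X)) := by
        ext1 <;> simp
      rw [hΦ, h1, h2, Units.mul_inv_cancel_right]
    obtain ⟨x⟩ := ‹Nonempty X›
    have h1 := hinv (inr ((1 : K) • 1))
    rw [hinr, hinr] at h1
    have h2 : k * (k * 1) = 1 := by simpa using congr(snd $h1 x x)
    exact mul_self_eq_one_iff.1 (by simpa using h2)

end Idealization

end IncidenceAlgebra

/-- Assume `X` is a connected locally finite poset satisfying conditions (M) and (D).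
Every `K`-algebra anti-automorphism `Φ` of `D(X,K)` has the form
`Φ = Ψ_θ ∘ ρ̃_λ ∘ k̃δ` for a unit `θ` of `D(X,K)`, an order anti-automorphism `λ` of
`X` and `k ∈ K*`.  Moreover, if `Φ` is an involution, then `λ` can be taken to be an
involution on `X` and `k ∈ {-1, 1}`. -/
theorem anti_automorphism_of_D_eq_inner_comp_rhoTilde_comp_kTilde
    (K X : Type*) [Field K] [PartialOrder X] [LocallyFiniteOrder X] [DecidableEq X]
    (hconn : PosetConnected X) (hM : CondM K X) (hD : CondD K X)
    (Φ : TrivSqZeroExt (IncidenceAlgebra K X) (IncidenceAlgebra K X) →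
         TrivSqZeroExt (IncidenceAlgebra K X) (IncidenceAlgebra K X))
    (hadd : ∀ u v, Φ (u + v) = Φ u + Φ v)
    (hsmul : ∀ (k : K) u, Φ (k • u) = k • Φ u)
    (hanti : ∀ u v, Φ (u * v) = Φ v * Φ u)
    (hbij : Function.Bijective Φ) :
    (∃ (θ : (TrivSqZeroExt (IncidenceAlgebra K X) (IncidenceAlgebra K X))ˣ)
        (lam : X → X) (hlam : ∀ x y : X, x ≤ y ↔ lam y ≤ lam x) (k : K),
      Function.Bijective lam ∧ k ≠ 0 ∧
      ∀ d, Φ d = ↑θ * rhoTilde K X lam hlam (kTilde K X k d) * ↑θ⁻¹) ∧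
    ((∀ u, Φ (Φ u) = u) →
      ∃ (θ : (TrivSqZeroExt (IncidenceAlgebra K X) (IncidenceAlgebra K X))ˣ)
          (lam : X → X) (hlam : ∀ x y : X, x ≤ y ↔ lam y ≤ lam x) (k : K),
        Function.Bijective lam ∧ (∀ x : X, lam (lam x) = x) ∧ (k = 1 ∨ k = -1) ∧
        ∀ d, Φ d = ↑θ * rhoTilde K X lam hlam (kTilde K X k d) * ↑θ⁻¹) := by
  rcases isEmpty_or_nonempty X with hX | hX
  · have hsub : ∀ u v : TrivSqZeroExt (IncidenceAlgebra K X) (IncidenceAlgebra K X), u = v :=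
      fun u v => TrivSqZeroExt.ext (IncidenceAlgebra.ext fun a => hX.elim a)
        (IncidenceAlgebra.ext fun a => hX.elim a)
    have hlam : ∀ x y : X, x ≤ y ↔ id y ≤ id x := fun x => hX.elim x
    exact ⟨⟨1, id, hlam, 1, Function.bijective_id, one_ne_zero, fun _ => hsub _ _⟩,
      fun _ => ⟨1, id, hlam, 1, Function.bijective_id, fun _ => rfl, Or.inl rfl,
        fun _ => hsub _ _⟩⟩
  · obtain ⟨θ, lam, hlam, k, hbl, hk, hΦ⟩ :=
      IncidenceAlgebra.exists_anti_eq_conj_rhoTilde_kTilde hconn hM hD hadd hsmul hanti hbij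
    refine ⟨⟨θ, lam, hlam, k, hbl, hk, hΦ⟩, fun hinv => ?_⟩
    obtain ⟨hll, hk1⟩ := IncidenceAlgebra.involutive_of_anti_involutive θ hlam k hΦ hinv
    exact ⟨θ, lam, hlam, k, hbl, hll, hk1, hΦ⟩
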